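/- Let E be an exact category with enough projectives and P a projective cover of E. Then E is locally cartesian closed (every slice E/I is cartesian closed) if and only if P is weakly locally cartesian closed, i.e. P has generalised weak dependent products. -/

import Mathlib

open CategoryTheory Limits

namespace ExComp

universe v u

variable {E : Type u} [Category.{v} E]

/-- A regular epimorphism, as a property of a morphism. -/
def RegEpi {A B : E} (f : A ⟶ B) : Prop := Nonempty (RegularEpi f)

/-- An object is (regular) projective if its covariant hom functor sends regular
epimorphisms to surjections. -/
def RegProjective (X : E) : Prop :=
  ∀ ⦃A B : E⦄ (e : A ⟶ B), RegEpi e → ∀ f : X ⟶ B, ∃ g : X ⟶ A, g ≫ e = f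

/-- `E` has enough projectives: every object admits a regular epimorphism from a
projective object. -/
def EnoughRegProjectives (E : Type u) [Category.{v} E] : Prop :=
  ∀ A : E, ∃ (X : E) (p : X ⟶ A), RegProjective X ∧ RegEpi p

/-- An internal equivalence relation: a jointly monic, reflexive, symmetric and
transitive pair of parallel arrows. -/
structure IsEquivRelPair {R X : E} (r₁ r₂ : R ⟶ X) : Prop where
  jointlyMono : ∀ ⦃T : E⦄ (h k : T ⟶ R), h ≫ r₁ = k ≫ r₁ → h ≫ r₂ = k ≫ r₂ → h = k
  refl : ∃ d : X ⟶ R, d ≫ r₁ = 𝟙 X ∧ d ≫ r₂ = 𝟙 X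
  symm : ∃ s : R ⟶ R, s ≫ r₁ = r₂ ∧ s ≫ r₂ = r₁
  trans : ∀ ⦃T : E⦄ (p q : T ⟶ R), p ≫ r₂ = q ≫ r₁ →
    ∃ t : T ⟶ R, t ≫ r₁ = p ≫ r₁ ∧ t ≫ r₂ = q ≫ r₂

/-- An exact category: a finitely complete category where every morphism factors as a
regular epi followed by a mono, regular epis are stable under pullback, and every
internal equivalence relation is effective (it is the kernel pair of the coequaliser
it admits). -/
structure IsExact (E : Type u) [Category.{v} E] [HasFiniteLimits E] : Prop where
  factor : ∀ ⦃A B : E⦄ (f : A ⟶ B), ∃ (I : E) (e : A ⟶ I) (m : I ⟶ B),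
    RegEpi e ∧ Mono m ∧ e ≫ m = f
  stable : ∀ ⦃A B C : E⦄ (f : A ⟶ B) (g : C ⟶ B), RegEpi f → RegEpi (pullback.snd f g)
  effective : ∀ ⦃R X : E⦄ (r₁ r₂ : R ⟶ X), IsEquivRelPair r₁ r₂ →
    ∃ (Q : E) (q : X ⟶ Q) (w : r₁ ≫ q = r₂ ≫ q),
      Nonempty (IsColimit (Cofork.ofπ q w)) ∧ IsPullback r₁ r₂ q q

/-- A projective cover of `E`: a (full sub)collection of objects, each projective,
such that every object of `E` admits a regular epimorphism from one of them. -/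
def IsProjectiveCover (P : Set E) : Prop :=
  (∀ X ∈ P, RegProjective X) ∧ ∀ A : E, ∃ X ∈ P, ∃ p : X ⟶ A, RegEpi p

section FinLim
variable [HasFiniteLimits E]

/-- `X` is internally projective: every arrow `T ⨯ X ⟶ B` lifts along a regular epi
`A ↠ B` after passing to a regular epi `U ↠ T`. -/
def InternallyProjective (X : E) : Prop :=
  ∀ ⦃T A B : E⦄ (e : A ⟶ B), RegEpi e → ∀ f : T ⨯ X ⟶ B,
    ∃ (U : E) (u : U ⟶ T) (g : U ⨯ X ⟶ A), RegEpi u ∧ g ≫ e = prod.map u (𝟙 X) ≫ f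

/-- Cartesian closure, as a property: for every object `X` the functor `(−) ⨯ X` has a
right adjoint. -/
def CartesianClosedP (E : Type u) [Category.{v} E] [HasFiniteLimits E] : Prop :=
  ∀ X : E, (prod.functor.flip.obj X).IsLeftAdjoint

/-- Local cartesian closure, as a property: every slice is cartesian closed. -/
def LocallyCartesianClosedP (E : Type u) [Category.{v} E] [HasFiniteLimits E] : Prop :=
  ∀ (I : E) (F : Over I), ((prod.functor (C := Over I)).flip.obj F).IsLeftAdjoint

end FinLim

/-! ## Weak products and weak simple products -/

/-- A weak product in `P` of `X` and `Y`: a span through which every span in `P`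
factors (not necessarily uniquely). -/
structure IsWeakProduct (P : Set E) {X Y V : E} (p : V ⟶ X) (q : V ⟶ Y) : Prop where
  mem : V ∈ P
  lift : ∀ ⦃V' : E⦄, V' ∈ P → ∀ (p' : V' ⟶ X) (q' : V' ⟶ Y),
    ∃ h : V' ⟶ V, h ≫ p = p' ∧ h ≫ q = q'

/-- An arrow out of a weak product is determined by projections if it coequalises
every pair of arrows (from an object of `P`) coequalised by both projections. -/
def DeterminedByProjections (P : Set E) {V X Y Z : E} (p : V ⟶ X) (q : V ⟶ Y)
    (f : V ⟶ Z) : Prop :=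
  ∀ ⦃V' : E⦄, V' ∈ P → ∀ (h k : V' ⟶ V), h ≫ p = k ≫ p → h ≫ q = k ≫ q → h ≫ f = k ≫ f

/-- A candidate diagram for a weak simple product of a span `J ←f Y →g X`. -/
structure WSPCone (P : Set E) {J Y X : E} (f : Y ⟶ J) (g : Y ⟶ X)
    (W V : E) (w : W ⟶ J) (p : V ⟶ W) (q : V ⟶ X) (e : V ⟶ Y) : Prop where
  memW : W ∈ P
  wp : IsWeakProduct P p q
  det : DeterminedByProjections P p q e
  comm₁ : p ≫ w = e ≫ f
  comm₂ : q = e ≫ g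

/-- A weak simple product: a weakly terminal candidate diagram. -/
structure IsWeakSimpleProduct (P : Set E) {J Y X : E} (f : Y ⟶ J) (g : Y ⟶ X)
    (W V : E) (w : W ⟶ J) (p : V ⟶ W) (q : V ⟶ X) (e : V ⟶ Y) : Prop where
  cone : WSPCone P f g W V w p q e
  lift : ∀ ⦃W' V' : E⦄ (w' : W' ⟶ J) (p' : V' ⟶ W') (q' : V' ⟶ X) (e' : V' ⟶ Y),
    WSPCone P f g W' V' w' p' q' e' →
    ∃ (α : W' ⟶ W) (β : V' ⟶ V),
      α ≫ w = w' ∧ β ≫ p = p' ≫ α ∧ β ≫ q = q' ∧ β ≫ e = e'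

/-- `P` has weak simple products. -/
def HasWeakSimpleProducts (P : Set E) : Prop :=
  ∀ ⦃J Y X : E⦄, J ∈ P → Y ∈ P → X ∈ P → ∀ (f : Y ⟶ J) (g : Y ⟶ X),
    ∃ (W V : E) (w : W ⟶ J) (p : V ⟶ W) (q : V ⟶ X) (e : V ⟶ Y),
      IsWeakSimpleProduct P f g W V w p q e

/-! ## Pseudo simple products -/

/-- A candidate diagram for a pseudo simple product (no determinacy requirement). -/
structure PSPCone (P : Set E) {J Y X : E} (f : Y ⟶ J) (g : Y ⟶ X)
    (W V : E) (w : W ⟶ J) (p : V ⟶ W) (q : V ⟶ X) (e : V ⟶ Y) : Prop where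
  memW : W ∈ P
  wp : IsWeakProduct P p q
  comm₁ : p ≫ w = e ≫ f
  comm₂ : q = e ≫ g

/-- A pseudo simple product: a weakly terminal candidate diagram. -/
structure IsPseudoSimpleProduct (P : Set E) {J Y X : E} (f : Y ⟶ J) (g : Y ⟶ X)
    (W V : E) (w : W ⟶ J) (p : V ⟶ W) (q : V ⟶ X) (e : V ⟶ Y) : Prop where
  cone : PSPCone P f g W V w p q e
  lift : ∀ ⦃W' V' : E⦄ (w' : W' ⟶ J) (p' : V' ⟶ W') (q' : V' ⟶ X) (e' : V' ⟶ Y),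
    PSPCone P f g W' V' w' p' q' e' →
    ∃ (α : W' ⟶ W) (β : V' ⟶ V),
      α ≫ w = w' ∧ β ≫ p = p' ≫ α ∧ β ≫ q = q' ∧ β ≫ e = e'

/-- `P` has pseudo simple products. -/
def HasPseudoSimpleProducts (P : Set E) : Prop :=
  ∀ ⦃J Y X : E⦄, J ∈ P → Y ∈ P → X ∈ P → ∀ (f : Y ⟶ J) (g : Y ⟶ X),
    ∃ (W V : E) (w : W ⟶ J) (p : V ⟶ W) (q : V ⟶ X) (e : V ⟶ Y),
      IsPseudoSimpleProduct P f g W V w p q e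

/-! ## Weak exponentials -/

/-- A candidate diagram for a weak exponential of `X` and `Y`. -/
structure WExpCone (P : Set E) {X Y : E} (W V : E) (p : V ⟶ W) (q : V ⟶ X)
    (e : V ⟶ Y) : Prop where
  memW : W ∈ P
  wp : IsWeakProduct P p q
  det : DeterminedByProjections P p q e

/-- A weak exponential of `X` and `Y` in `P`. -/
structure IsWeakExponential (P : Set E) {X Y : E} (W V : E) (p : V ⟶ W) (q : V ⟶ X)
    (e : V ⟶ Y) : Prop where
  cone : WExpCone P W V p q e
  lift : ∀ ⦃W' V' : E⦄ (p' : V' ⟶ W') (q' : V' ⟶ X) (e' : V' ⟶ Y),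
    WExpCone P W' V' p' q' e' →
    ∃ (α : W' ⟶ W) (β : V' ⟶ V), β ≫ p = p' ≫ α ∧ β ≫ q = q' ∧ β ≫ e = e'

/-- `P` has weak exponentials. -/
def HasWeakExponentials (P : Set E) : Prop :=
  ∀ ⦃X Y : E⦄, X ∈ P → Y ∈ P →
    ∃ (W V : E) (p : V ⟶ W) (q : V ⟶ X) (e : V ⟶ Y), IsWeakExponential P W V p q e

/-- A quasi exponential of `X` and `B`: the weak universal property of an exponential
restricted to projective sources. -/
def IsQuasiExponential [HasFiniteLimits E] (P : Set E) (X : E) {B : E} (W : E)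
    (e : W ⨯ X ⟶ B) : Prop :=
  ∀ ⦃Z : E⦄, Z ∈ P → ∀ f : Z ⨯ X ⟶ B, ∃ g : Z ⟶ W, prod.map g (𝟙 X) ≫ e = f

section FinLim2
variable [HasFiniteLimits E]

/-! ## Pseudo equivalence relations, equalities and generalised weak (simple) products -/

/-- A pseudo equivalence relation: a pair of parallel arrows whose image in `E` is an
equivalence relation. -/
def IsPseudoEquivRel {Y1 Y0 : E} (y₁ y₂ : Y1 ⟶ Y0) : Prop :=
  ∃ (R : E) (e : Y1 ⟶ R) (m : R ⟶ Y0 ⨯ Y0), RegEpi e ∧ Mono m ∧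
    e ≫ m = prod.lift y₁ y₂ ∧ IsEquivRelPair (m ≫ prod.fst) (m ≫ prod.snd)

/-- An equality for a weak limit, relative to the comparison arrow `c : V0 ⟶ L` into
the actual limit: a pseudo equivalence relation `v₁, v₂ : V1 ⇉ V0` in `P` such that
`c` is a coequaliser of `v₁, v₂` and `V1` regularly covers the kernel pair of `c`. -/
structure IsEqualityFor (P : Set E) {V1 V0 L : E} (c : V0 ⟶ L) (v₁ v₂ : V1 ⟶ V0) :
    Prop where
  mem : V1 ∈ P
  per : IsPseudoEquivRel v₁ v₂
  w : v₁ ≫ c = v₂ ≫ c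
  coeq : Nonempty (IsColimit (Cofork.ofπ c w))
  cover : RegEpi (pullback.lift v₁ v₂ w)

/-- An arrow `e : V ⟶ Z0` out of a weak product with projections `p, q` preserves
projections with respect to a pseudo equivalence relation `z₁, z₂ : Z1 ⇉ Z0` if for
any equality `v₁, v₂ : V1 ⇉ V` for the weak product there is `t : V1 ⟶ Z1` with
`t ≫ zᵢ = vᵢ ≫ e`. -/
def PreservesProjWP (P : Set E) {V X Y Z1 Z0 : E} (p : V ⟶ X) (q : V ⟶ Y)
    (z₁ z₂ : Z1 ⟶ Z0) (e : V ⟶ Z0) : Prop :=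
  ∀ ⦃V1 : E⦄ (v₁ v₂ : V1 ⟶ V), IsEqualityFor P (prod.lift p q) v₁ v₂ →
    ∃ t : V1 ⟶ Z1, t ≫ z₁ = v₁ ≫ e ∧ t ≫ z₂ = v₂ ≫ e

/-- A candidate diagram for a generalised weak simple product of `f` and `g` with
respect to the pseudo equivalence relation `y₁, y₂`. -/
structure GWSPCone (P : Set E) {Y1 Y0 J X : E} (y₁ y₂ : Y1 ⟶ Y0) (f : Y0 ⟶ J)
    (g : Y0 ⟶ X) (W V : E) (w : W ⟶ J) (p : V ⟶ W) (q : V ⟶ X) (e : V ⟶ Y0) :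
    Prop where
  memW : W ∈ P
  wp : IsWeakProduct P p q
  pres : PreservesProjWP P p q y₁ y₂ e
  comm₁ : p ≫ w = e ≫ f
  comm₂ : q = e ≫ g

/-- A generalised weak simple product: a weakly terminal candidate diagram. -/
structure IsGWSP (P : Set E) {Y1 Y0 J X : E} (y₁ y₂ : Y1 ⟶ Y0) (f : Y0 ⟶ J)
    (g : Y0 ⟶ X) (W V : E) (w : W ⟶ J) (p : V ⟶ W) (q : V ⟶ X) (e : V ⟶ Y0) :
    Prop where
  cone : GWSPCone P y₁ y₂ f g W V w p q e
  lift : ∀ ⦃W' V' : E⦄ (w' : W' ⟶ J) (p' : V' ⟶ W') (q' : V' ⟶ X) (e' : V' ⟶ Y0),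
    GWSPCone P y₁ y₂ f g W' V' w' p' q' e' →
    ∃ (α : W' ⟶ W) (β : V' ⟶ V),
      α ≫ w = w' ∧ β ≫ p = p' ≫ α ∧ β ≫ q = q' ∧ β ≫ e = e'

/-- `P` has generalised weak simple products. -/
def HasGWSP (P : Set E) : Prop :=
  ∀ ⦃Y1 Y0 J X : E⦄, Y1 ∈ P → Y0 ∈ P → J ∈ P → X ∈ P →
    ∀ (y₁ y₂ : Y1 ⟶ Y0), IsPseudoEquivRel y₁ y₂ →
    ∀ (f : Y0 ⟶ J) (g : Y0 ⟶ X), y₁ ≫ f = y₂ ≫ f → y₁ ≫ g = y₂ ≫ g →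
    ∃ (W V : E) (w : W ⟶ J) (p : V ⟶ W) (q : V ⟶ X) (e : V ⟶ Y0),
      IsGWSP P y₁ y₂ f g W V w p q e

/-- A candidate diagram for a generalised weak exponential of `X` and `y₁, y₂`. -/
structure GWExpCone (P : Set E) {X Y1 Y0 : E} (y₁ y₂ : Y1 ⟶ Y0)
    (W V : E) (p : V ⟶ W) (q : V ⟶ X) (e : V ⟶ Y0) : Prop where
  memW : W ∈ P
  wp : IsWeakProduct P p q
  pres : PreservesProjWP P p q y₁ y₂ e

/-- A generalised weak exponential of `X` and a pseudo equivalence relation. -/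
structure IsGWExp (P : Set E) {X Y1 Y0 : E} (y₁ y₂ : Y1 ⟶ Y0)
    (W V : E) (p : V ⟶ W) (q : V ⟶ X) (e : V ⟶ Y0) : Prop where
  cone : GWExpCone P y₁ y₂ W V p q e
  lift : ∀ ⦃W' V' : E⦄ (p' : V' ⟶ W') (q' : V' ⟶ X) (e' : V' ⟶ Y0),
    GWExpCone P y₁ y₂ W' V' p' q' e' →
    ∃ (α : W' ⟶ W) (β : V' ⟶ V), β ≫ p = p' ≫ α ∧ β ≫ q = q' ∧ β ≫ e = e'

/-! ## Weak pullbacks and generalised weak dependent products -/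

/-- A weak pullback in `P` of the cospan `X →f J ←w W`. -/
structure IsWeakPullback (P : Set E) {X J W V : E} (f : X ⟶ J) (w : W ⟶ J)
    (a : V ⟶ X) (b : V ⟶ W) : Prop where
  mem : V ∈ P
  comm : a ≫ f = b ≫ w
  lift : ∀ ⦃V' : E⦄, V' ∈ P → ∀ (a' : V' ⟶ X) (b' : V' ⟶ W), a' ≫ f = b' ≫ w →
    ∃ h : V' ⟶ V, h ≫ a = a' ∧ h ≫ b = b'

/-- Preservation of projections for an arrow out of a weak pullback. -/
def PreservesProjWPB (P : Set E) {V X J W Z1 Z0 : E} (f : X ⟶ J) (w : W ⟶ J)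
    (a : V ⟶ X) (b : V ⟶ W) (h : a ≫ f = b ≫ w) (z₁ z₂ : Z1 ⟶ Z0) (e : V ⟶ Z0) :
    Prop :=
  ∀ ⦃V1 : E⦄ (v₁ v₂ : V1 ⟶ V), IsEqualityFor P (pullback.lift a b h) v₁ v₂ →
    ∃ t : V1 ⟶ Z1, t ≫ z₁ = v₁ ≫ e ∧ t ≫ z₂ = v₂ ≫ e

/-- A candidate diagram for a generalised weak dependent product of `g : Y0 ⟶ X`
along `f : X ⟶ J` with respect to `y₁, y₂`. -/
structure GWDPCone (P : Set E) {Y1 Y0 X J : E} (y₁ y₂ : Y1 ⟶ Y0) (g : Y0 ⟶ X)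
    (f : X ⟶ J) (W V : E) (w : W ⟶ J) (a : V ⟶ X) (b : V ⟶ W) (e : V ⟶ Y0) :
    Prop where
  memW : W ∈ P
  comm : a ≫ f = b ≫ w
  wpb : IsWeakPullback P f w a b
  overX : e ≫ g = a
  pres : PreservesProjWPB P f w a b comm y₁ y₂ e

/-- A generalised weak dependent product: a weakly terminal candidate diagram. -/
structure IsGWDP (P : Set E) {Y1 Y0 X J : E} (y₁ y₂ : Y1 ⟶ Y0) (g : Y0 ⟶ X)
    (f : X ⟶ J) (W V : E) (w : W ⟶ J) (a : V ⟶ X) (b : V ⟶ W) (e : V ⟶ Y0) :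
    Prop where
  cone : GWDPCone P y₁ y₂ g f W V w a b e
  lift : ∀ ⦃W' V' : E⦄ (w' : W' ⟶ J) (a' : V' ⟶ X) (b' : V' ⟶ W') (e' : V' ⟶ Y0),
    GWDPCone P y₁ y₂ g f W' V' w' a' b' e' →
    ∃ (α : W' ⟶ W) (β : V' ⟶ V),
      α ≫ w = w' ∧ β ≫ a = a' ∧ β ≫ b = b' ≫ α ∧ β ≫ e = e'

/-- `P` has generalised weak dependent products (i.e. `P` is weakly locally cartesian
closed). -/
def HasGWDP (P : Set E) : Prop :=
  ∀ ⦃Y1 Y0 X J : E⦄, Y1 ∈ P → Y0 ∈ P → X ∈ P → J ∈ P →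
    ∀ (y₁ y₂ : Y1 ⟶ Y0), IsPseudoEquivRel y₁ y₂ →
    ∀ (g : Y0 ⟶ X) (f : X ⟶ J), y₁ ≫ g = y₂ ≫ g →
    ∃ (W V : E) (w : W ⟶ J) (a : V ⟶ X) (b : V ⟶ W) (e : V ⟶ Y0),
      IsGWDP P y₁ y₂ g f W V w a b e

/-! ## The functor `w_X` on subobjects induced by weak simple products -/

/-- The adjunction property of the weak-simple-product operation `w_X` on subobjects:
for every subobject `a : A ↪ J ⨯ X`, every `P`-cover `Y ↠ A`, every weak simple
product `W → J` of the induced span and every image factorisation `W ↠ I ↪ J` of it,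
the subobject `I ↪ J` is a value at `a` of a right adjoint to
`(−) ⨯ X : Sub(J) → Sub(J ⨯ X)`. -/
def WAdj (P : Set E) (J X : E) : Prop :=
  ∀ ⦃A : E⦄ (a : A ⟶ J ⨯ X), Mono a →
  ∀ ⦃Y : E⦄, Y ∈ P → ∀ (c : Y ⟶ A), RegEpi c →
  ∀ ⦃W V : E⦄ (w : W ⟶ J) (p : V ⟶ W) (q : V ⟶ X) (e : V ⟶ Y),
    IsWeakSimpleProduct P (c ≫ a ≫ prod.fst) (c ≫ a ≫ prod.snd) W V w p q e →
  ∀ ⦃I : E⦄ (ew : W ⟶ I) (m : I ⟶ J), RegEpi ew → Mono m → ew ≫ m = w →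
  ∀ ⦃B : E⦄ (b : B ⟶ J), Mono b →
    ((∃ t : B ⨯ X ⟶ A, t ≫ a = prod.map b (𝟙 X)) ↔ ∃ s : B ⟶ I, s ≫ m = b)

/-! ## Weak dependent products (à la Carboni–Rosolini) -/

/-- `P` has weak dependent products: for `f : X ⟶ J` and `g : Y ⟶ X` in `P` there are
`w : W ⟶ J` in `P` and a surjection `Hom_{P/J}(h, w) → Hom_{P/X}(f*(h), g)` natural
in `h ∈ P/J`. -/
def HasWeakDependentProducts (P : Set E) : Prop :=
  ∀ ⦃X J Y : E⦄, X ∈ P → J ∈ P → Y ∈ P → ∀ (f : X ⟶ J) (g : Y ⟶ X),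
    ∃ (W : E) (_ : W ∈ P) (w : W ⟶ J)
      (ε : ∀ ⦃T : E⦄, T ∈ P → ∀ (h : T ⟶ J) (k : T ⟶ W), k ≫ w = h →
        (pullback h f ⟶ Y)),
      (∀ ⦃T : E⦄ (hT : T ∈ P) (h : T ⟶ J) (k : T ⟶ W) (hk : k ≫ w = h),
         ε hT h k hk ≫ g = pullback.snd h f) ∧
      (∀ ⦃T : E⦄ (hT : T ∈ P) (h : T ⟶ J) (d : pullback h f ⟶ Y),
         d ≫ g = pullback.snd h f → ∃ (k : T ⟶ W) (hk : k ≫ w = h), ε hT h k hk = d) ∧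
      (∀ ⦃T' T : E⦄ (hT' : T' ∈ P) (hT : T ∈ P) (u : T' ⟶ T) (h : T ⟶ J) (k : T ⟶ W)
         (hk : k ≫ w = h),
         ε hT' (u ≫ h) (u ≫ k) (by rw [Category.assoc, hk]) =
           pullback.map (u ≫ h) f h f u (𝟙 X) (𝟙 J) (by simp) (by simp) ≫ ε hT h k hk)

end FinLim2

section Aux

attribute [local simp] pullback.lift_fst pullback.lift_fst_assoc pullback.lift_snd
  pullback.lift_snd_assoc prod.lift_fst prod.lift_fst_assoc prod.lift_snd prod.lift_snd_assoc

theorem RegEpi.epi' {A B : E} {f : A ⟶ B} (h : RegEpi f) : Epi f := by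
  obtain ⟨r⟩ := h
  exact RegularEpi.epi f r

theorem cover_ext {P : Set E} (hP : IsProjectiveCover P) {A B : E} {F G : A ⟶ B}
    (h : ∀ Q ∈ P, ∀ a : Q ⟶ A, a ≫ F = a ≫ G) : F = G := by
  obtain ⟨Q, hQ, p, hp⟩ := hP.2 A
  have := hp.epi'
  exact (cancel_epi p).1 (h Q hQ p)

theorem mapOfRel {P : Set E} (hP : IsProjectiveCover P) {A B : E}
    (Rel : ∀ Q : E, (Q ⟶ A) → (Q ⟶ B) → Prop)
    (nat : ∀ Q ∈ P, ∀ Q' ∈ P, ∀ (r : Q' ⟶ Q) (a : Q ⟶ A) (b : Q ⟶ B),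
      Rel Q a b → Rel Q' (r ≫ a) (r ≫ b))
    (ex : ∀ Q ∈ P, ∀ a : Q ⟶ A, ∃ b, Rel Q a b)
    (un : ∀ Q ∈ P, ∀ (a : Q ⟶ A) (b b' : Q ⟶ B), Rel Q a b → Rel Q a b' → b = b') :
    ∃ F : A ⟶ B, ∀ Q ∈ P, ∀ a : Q ⟶ A, Rel Q a (a ≫ F) := by
  obtain ⟨Q0, h0, p, hp⟩ := hP.2 A
  obtain ⟨b0, hb0⟩ := ex Q0 h0 p
  obtain ⟨r⟩ := id hp
  obtain ⟨Q1, h1, c, hc⟩ := hP.2 r.W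
  have := hc.epi'
  have key : r.left ≫ b0 = r.right ≫ b0 := by
    rw [← cancel_epi c]
    have e1 := nat Q0 h0 Q1 h1 (c ≫ r.left) p b0 hb0
    have e2 := nat Q0 h0 Q1 h1 (c ≫ r.right) p b0 hb0
    rw [Category.assoc, r.w, ← Category.assoc] at e1
    simpa using un Q1 h1 _ _ _ e1 e2
  obtain ⟨F, hF⟩ := Cofork.IsColimit.desc' r.isColimit b0 key
  have hF' : p ≫ F = b0 := hF
  refine ⟨F, fun Q hQ a => ?_⟩
  obtain ⟨a', rfl⟩ := hP.1 Q hQ p hp a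
  rw [Category.assoc, hF']
  exact nat Q0 h0 Q hQ a' p b0 hb0

/-- factoring through a mono can be tested on elements. -/
theorem factor_mono {P : Set E} (hP : IsProjectiveCover P) {A J B : E} (n : B ⟶ J) [Mono n]
    (s : A ⟶ J) (h : ∀ Q ∈ P, ∀ q : Q ⟶ A, ∃ b, b ≫ n = q ≫ s) : ∃ b, b ≫ n = s := by
  obtain ⟨F, hF⟩ := mapOfRel hP (fun Q (a : Q ⟶ A) (b : Q ⟶ B) => b ≫ n = a ≫ s)
    (by intro Q _ Q' _ r a b e; simp [e]) h
    (by intro Q _ a b b' e e'; rw [← cancel_mono n, e, e'])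
  exact ⟨F, cover_ext hP fun Q hQ a => by simpa using hF Q hQ a⟩

variable [HasFiniteLimits E]

theorem surj_regEpi (hE : IsExact E) {P : Set E} (hP : IsProjectiveCover P) {A B : E} (f : A ⟶ B)
    (h : ∀ Q ∈ P, ∀ b : Q ⟶ B, ∃ a, a ≫ f = b) : RegEpi f := by
  obtain ⟨I, e, m, he, hm, rfl⟩ := hE.factor f
  obtain ⟨s, hs⟩ := factor_mono hP m (𝟙 B) (fun Q hQ q => by
    obtain ⟨a, rfl⟩ := h Q hQ q
    exact ⟨a ≫ e, by simp⟩)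
  have hs' : m ≫ s = 𝟙 _ := by rw [← cancel_mono m]; simp [hs]
  let i : I ≅ B := ⟨m, s, hs', hs⟩
  obtain ⟨r⟩ := he
  exact ⟨RegularEpi.ofArrowIso
    (Arrow.isoMk (f := Arrow.mk e) (g := Arrow.mk (e ≫ m)) (Iso.refl _) i (by simp [i])) r⟩

/-- An equality exists, whose kernel pair is covered. -/
theorem exists_equality {P : Set E} (hP : IsProjectiveCover P) {V L : E} (c : V ⟶ L)
    (hc : RegEpi c) : ∃ (V1 : E) (v₁ v₂ : V1 ⟶ V), IsEqualityFor P c v₁ v₂ ∧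
      ∀ Q ∈ P, ∀ a b : Q ⟶ V, a ≫ c = b ≫ c → ∃ t : Q ⟶ V1, t ≫ v₁ = a ∧ t ≫ v₂ = b := by
  obtain ⟨V1, h1, k, hk⟩ := hP.2 (pullback c c)
  have := hk.epi'
  refine ⟨V1, k ≫ pullback.fst c c, k ≫ pullback.snd c c, ⟨h1, ?_, ?_, ?_, ?_⟩, ?_⟩
  · refine ⟨pullback c c, k, prod.lift (pullback.fst c c) (pullback.snd c c), hk, ?_, ?_, ?_⟩
    · constructor
      intro Z g h e
      apply pullback.hom_ext
      · simpa using congr($e ≫ prod.fst)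
      · simpa using congr($e ≫ prod.snd)
    · ext <;> simp
    · simp only [prod.lift_fst, prod.lift_snd]
      refine ⟨fun T h k e1 e2 => pullback.hom_ext e1 e2, ⟨pullback.lift (𝟙 _) (𝟙 _) rfl, by simp⟩,
        ⟨pullback.lift (pullback.snd c c) (pullback.fst c c) pullback.condition.symm, by simp⟩, ?_⟩
      intro T p q e
      refine ⟨pullback.lift (p ≫ pullback.fst c c) (q ≫ pullback.snd c c) ?_,
        pullback.lift_fst _ _ _, pullback.lift_snd _ _ _⟩
      rw [Category.assoc, pullback.condition, reassoc_of% e, pullback.condition, Category.assoc]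
  · simp [pullback.condition]
  · obtain ⟨r⟩ := hc
    have := RegularEpi.epi c r
    refine ⟨Cofork.IsColimit.mk' _ fun s => ?_⟩
    have hs : r.left ≫ s.π = r.right ≫ s.π := by
      have h := s.condition
      rw [Category.assoc, Category.assoc, cancel_epi] at h
      have := congr(pullback.lift r.left r.right r.w ≫ $h)
      simpa using this
    obtain ⟨F, hF⟩ := Cofork.IsColimit.desc' r.isColimit s.π hs
    refine ⟨F, hF, ?_⟩
    intro m hm
    rw [← cancel_epi c]
    exact hm.trans hF.symm
  · convert hk
    apply pullback.hom_ext <;> simp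
  · intro Q hQ a b e
    obtain ⟨t, ht⟩ := hP.1 Q hQ k hk (pullback.lift a b e)
    refine ⟨t, ?_, ?_⟩
    · rw [reassoc_of% ht]; simp
    · rw [reassoc_of% ht]; simp

/-- Compatibility of `φ` with the pullback of `ev` along `α`, on elements. -/
def Good (P : Set E) {X J Y T W : E} (f : X ⟶ J) (h : T ⟶ J) (φ : pullback f h ⟶ Y)
    (w : W ⟶ J) (ev : pullback f w ⟶ Y) (α : T ⟶ W) : Prop :=
  ∀ Q ∈ P, ∀ (z : Q ⟶ pullback f h) (z' : Q ⟶ pullback f w),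
    z ≫ pullback.fst f h = z' ≫ pullback.fst f w →
    z ≫ pullback.snd f h ≫ α = z' ≫ pullback.snd f w → z ≫ φ = z' ≫ ev

/-- weak dependent product for tests in P -/
def WPi (P : Set E) {X J Y : E} (f : X ⟶ J) (g : Y ⟶ X) {W : E} (w : W ⟶ J)
    (ev : pullback f w ⟶ Y) : Prop :=
  ev ≫ g = pullback.fst f w ∧ ∀ T ∈ P, ∀ (h : T ⟶ J) (φ : pullback f h ⟶ Y),
    φ ≫ g = pullback.fst f h → ∃ α : T ⟶ W, α ≫ w = h ∧ Good P f h φ w ev α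

theorem lemA (hE : IsExact E) {P : Set E} (hP : IsProjectiveCover P) (H : HasGWDP P)
    {X J Y : E} (hX : X ∈ P) (hJ : J ∈ P) (f : X ⟶ J) (g : Y ⟶ X) :
    ∃ (W : E) (w : W ⟶ J) (ev : pullback f w ⟶ Y), WPi P f g w ev := by
  obtain ⟨Y0, hY0, c, hc⟩ := hP.2 Y
  obtain ⟨Y1, y₁, y₂, hy, hy'⟩ := exists_equality hP c hc
  obtain ⟨W, V, w, a, b, e, hW⟩ := H hy.mem hY0 hX hJ y₁ y₂ hy.per (c ≫ g) f
    (by rw [reassoc_of% hy.w])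
  have hV := hW.cone.wpb
  have hsurj : RegEpi (pullback.lift a b hV.comm) := surj_regEpi hE hP _ (fun Q hQ z => by
    obtain ⟨h, h1, h2⟩ := hV.lift hQ (z ≫ pullback.fst f w) (z ≫ pullback.snd f w)
      (by simp [pullback.condition])
    exact ⟨h, by apply pullback.hom_ext <;> simp [h1, h2]⟩)
  obtain ⟨V1, v₁, v₂, hv, hv'⟩ := exists_equality hP _ hsurj
  obtain ⟨t, ht1, ht2⟩ := hW.cone.pres v₁ v₂ hv
  have uniq : ∀ Q ∈ P, ∀ v v' : Q ⟶ V, v ≫ a = v' ≫ a → v ≫ b = v' ≫ b →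
      v ≫ e ≫ c = v' ≫ e ≫ c := by
    intro Q hQ v v' e1 e2
    obtain ⟨s, rfl, rfl⟩ := hv' Q hQ v v' (by apply pullback.hom_ext <;> simp [e1, e2])
    simp only [Category.assoc]
    rw [← reassoc_of% ht1, ← reassoc_of% ht2, hy.w]
  obtain ⟨ev, hev⟩ := mapOfRel hP (A := pullback f w) (B := Y)
    (fun Q z y => ∃ v : Q ⟶ V, v ≫ a = z ≫ pullback.fst f w ∧
      v ≫ b = z ≫ pullback.snd f w ∧ v ≫ e ≫ c = y)
    (by
      rintro Q _ Q' _ r z y ⟨v, h1, h2, h3⟩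
      exact ⟨r ≫ v, by simp [h1], by simp [h2], by simp [h3]⟩)
    (by
      intro Q hQ z
      obtain ⟨h, h1, h2⟩ := hV.lift hQ (z ≫ pullback.fst f w) (z ≫ pullback.snd f w)
        (by simp [pullback.condition])
      exact ⟨_, h, h1, h2, rfl⟩)
    (by
      rintro Q hQ z y y' ⟨v, h1, h2, rfl⟩ ⟨v', h1', h2', rfl⟩
      exact uniq Q hQ v v' (h1.trans h1'.symm) (h2.trans h2'.symm))
  refine ⟨W, w, ev, cover_ext hP fun Q hQ z => ?_, ?_⟩
  · obtain ⟨v, h1, h2, h3⟩ := hev Q hQ z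
    rw [← Category.assoc, ← h3, ← h1, ← hW.cone.overX]
    simp
  intro T hT h φ hφ
  obtain ⟨V', hV', p, hp⟩ := hP.2 (pullback f h)
  obtain ⟨e', he'⟩ := hP.1 V' hV' c hc (p ≫ φ)
  obtain ⟨α, β, h1, h2, h3, h4⟩ := hW.lift h (p ≫ pullback.fst f h) (p ≫ pullback.snd f h) e'
    { memW := hT
      comm := by simp [pullback.condition]
      wpb := ⟨hV', by simp [pullback.condition], fun V'' h'' a' b' hab => by
        obtain ⟨k, hk⟩ := hP.1 V'' h'' p hp (pullback.lift a' b' hab)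
        refine ⟨k, ?_, ?_⟩
        · rw [reassoc_of% hk]; simp
        · rw [reassoc_of% hk]; simp⟩
      overX := by rw [reassoc_of% he', hφ]
      pres := by
        intro V1 v₁ v₂ hv
        refine hy' V1 hv.mem _ _ ?_
        have hw := hv.w
        have : pullback.lift (p ≫ pullback.fst f h) (p ≫ pullback.snd f h)
            (by simp [pullback.condition]) = p := by apply pullback.hom_ext <;> simp
        rw [this] at hw
        rw [Category.assoc, he', Category.assoc, he', reassoc_of% hw] }
  refine ⟨α, h1, ?_⟩
  intro Q hQ z z' e1 e2
  obtain ⟨q, rfl⟩ := hP.1 Q hQ p hp z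
  obtain ⟨v, k1, k2, k3⟩ := hev Q hQ z'
  rw [Category.assoc, ← he', ← h4, ← k3]
  have := uniq Q hQ (q ≫ β) v (by rw [k1, ← e1, Category.assoc, h2, Category.assoc])
    (by rw [k2, ← e2, Category.assoc, h3]; simp)
  simpa using this


theorem lemB (hE : IsExact E) {P : Set E} (hP : IsProjectiveCover P) (H : HasGWDP P)
    {X J Y : E} (f : X ⟶ J) (u v : X ⟶ Y) :
    ∃ (B : E) (n : B ⟶ J), Mono n ∧ ∀ Q ∈ P, ∀ j : Q ⟶ J,
      (∃ b, b ≫ n = j) ↔ ∀ Q' ∈ P, ∀ (r : Q' ⟶ Q) (x : Q' ⟶ X), x ≫ f = r ≫ j →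
        x ≫ u = x ≫ v := by
  obtain ⟨J0, hJ0, p, hp⟩ := hP.2 J
  obtain ⟨X0, hX0, c, hc⟩ := hP.2 (pullback f p)
  obtain ⟨W, w, ev, hev, hW⟩ := lemA hE hP H hX0 hJ0 (c ≫ pullback.snd f p)
    (equalizer.ι (c ≫ pullback.fst f p ≫ u) (c ≫ pullback.fst f p ≫ v))
  obtain ⟨B, e, n, he, hn, hen⟩ := hE.factor (w ≫ p)
  refine ⟨B, n, hn, fun Q hQ j => ⟨?_, ?_⟩⟩
  · rintro ⟨b, rfl⟩ Q' hQ' r x hx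
    obtain ⟨k, rfl⟩ := hP.1 Q hQ e he b
    obtain ⟨x0, hx0⟩ := hP.1 Q' hQ' c hc (pullback.lift x (r ≫ k ≫ w) (by
      rw [hx]; simp [hen]))
    have e1 : x0 ≫ c ≫ pullback.fst f p = x := by rw [reassoc_of% hx0]; simp
    have e2 : x0 ≫ c ≫ pullback.snd f p = r ≫ k ≫ w := by rw [reassoc_of% hx0]; simp
    let z : Q' ⟶ pullback (c ≫ pullback.snd f p) w := pullback.lift x0 (r ≫ k) (by simpa using e2)
    have hz : x0 = z ≫ ev ≫ equalizer.ι _ _ := by rw [hev]; simp [z]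
    have := equalizer.condition (c ≫ pullback.fst f p ≫ u) (c ≫ pullback.fst f p ≫ v)
    have h3 := congr(z ≫ ev ≫ $this)
    simp only [← Category.assoc] at h3 hz
    rw [← hz] at h3
    simp only [Category.assoc] at h3
    rw [← e1]
    simpa using h3
  · intro h
    obtain ⟨j0, rfl⟩ := hP.1 Q hQ p hp j
    obtain ⟨α, h1, h2⟩ := hW Q hQ j0 (equalizer.lift (pullback.fst _ _)
      (cover_ext hP fun Q' hQ' z => by
        have := h Q' hQ' (z ≫ pullback.snd _ _) (z ≫ pullback.fst _ _ ≫ c ≫ pullback.fst f p) (by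
          have := pullback.condition (f := c ≫ pullback.snd f p) (g := j0)
          simp only [Category.assoc]
          rw [← reassoc_of% this, pullback.condition])
        simpa using this)) (by simp)
    exact ⟨α ≫ e, by rw [Category.assoc, hen, reassoc_of% h1]⟩

theorem lemC (hE : IsExact E) {P : Set E} (hP : IsProjectiveCover P) (H : HasGWDP P)
    {X J Y : E} (f : X ⟶ J) (g : Y ⟶ X) :
    ∃ (W : E) (w : W ⟶ J) (ev : pullback f w ⟶ Y), WPi P f g w ev := by
  obtain ⟨J0, hJ0, p, hp⟩ := hP.2 J
  obtain ⟨X0, hX0, c, hc⟩ := hP.2 (pullback f p)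
  obtain ⟨x0, hx0⟩ : ∃ x0, x0 = c ≫ pullback.fst f p := ⟨_, rfl⟩
  obtain ⟨f0, hf0⟩ : ∃ f0, f0 = c ≫ pullback.snd f p := ⟨_, rfl⟩
  have sq : x0 ≫ f = f0 ≫ p := by rw [hx0, hf0]; simp [pullback.condition]
  have lft : ∀ Q ∈ P, ∀ (x : Q ⟶ X) (j : Q ⟶ J0), x ≫ f = j ≫ p →
      ∃ q : Q ⟶ X0, q ≫ x0 = x ∧ q ≫ f0 = j := by
    intro Q hQ x j e
    obtain ⟨q, hq⟩ := hP.1 Q hQ c hc (pullback.lift x j e)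
    refine ⟨q, ?_, ?_⟩
    · rw [hx0, reassoc_of% hq]; simp
    · rw [hf0, reassoc_of% hq]; simp
  obtain ⟨W0, w0, ev0, hev0, hW0⟩ := lemA hE hP H hX0 hJ0 f0 (pullback.snd g x0)
  let d : pullback f0 w0 ⟶ W0 ⨯ X := prod.lift (pullback.snd _ _) (pullback.fst _ _ ≫ x0)
  obtain ⟨S, n, hn, hS⟩ := lemB hE hP H (pullback.fst d d ≫ pullback.snd f0 w0)
    (pullback.fst d d ≫ ev0 ≫ pullback.fst g x0) (pullback.snd d d ≫ ev0 ≫ pullback.fst g x0)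
  obtain ⟨ev, hev⟩ := mapOfRel hP (A := pullback f (n ≫ w0 ≫ p)) (B := Y)
    (fun Q z y => ∃ a : Q ⟶ pullback f0 w0, a ≫ pullback.fst _ _ ≫ x0 = z ≫ pullback.fst _ _ ∧
      a ≫ pullback.snd _ _ = z ≫ pullback.snd _ _ ≫ n ∧ a ≫ ev0 ≫ pullback.fst g x0 = y)
    (by
      rintro Q _ Q' _ r z y ⟨v, h1, h2, h3⟩
      exact ⟨r ≫ v, by simp [h1], by simp [h2], by simp [h3]⟩)
    (by
      intro Q hQ z
      obtain ⟨q, h1, h2⟩ := lft Q hQ (z ≫ pullback.fst _ _) (z ≫ pullback.snd _ _ ≫ n ≫ w0)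
        (by simp [pullback.condition])
      exact ⟨_, pullback.lift q (z ≫ pullback.snd _ _ ≫ n) (by simp [h2]), by simp [h1], by simp,
        rfl⟩)
    (by
      rintro Q hQ z y y' ⟨v, h1, h2, rfl⟩ ⟨v', h1', h2', rfl⟩
      have := (hS Q hQ (z ≫ pullback.snd _ _ ≫ n)).1 ⟨z ≫ pullback.snd _ _, by simp⟩ Q hQ (𝟙 _)
        (pullback.lift v v' (by apply Limits.prod.hom_ext <;> simp [d, h1, h2, h1', h2']))
        (by simp [h2])
      simpa using this)
  refine ⟨S, n ≫ w0 ≫ p, ev, cover_ext hP fun Q hQ z => ?_, ?_⟩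
  · obtain ⟨v, h1, h2, h3⟩ := hev Q hQ z
    rw [← Category.assoc, ← h3, ← h1, ← hev0]
    simp [pullback.condition]
  intro T hT h φ hφ
  obtain ⟨h0, rfl⟩ := hP.1 T hT p hp h
  let ψ : pullback f0 h0 ⟶ pullback f (h0 ≫ p) :=
    pullback.lift (pullback.fst _ _ ≫ x0) (pullback.snd _ _)
      (by rw [Category.assoc, sq, pullback.condition_assoc])
  obtain ⟨α0, k1, k2⟩ := hW0 T hT h0 (pullback.lift (ψ ≫ φ) (pullback.fst _ _)
    (by rw [Category.assoc, hφ]; simp [ψ])) (by simp)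
  obtain ⟨α, rfl⟩ := (hS T hT α0).2 (by
    intro Q' hQ' r k e
    have hd := pullback.condition (f := d) (g := d)
    have hd1 : k ≫ pullback.snd d d ≫ pullback.snd f0 w0 = r ≫ α0 := by
      have := congr(k ≫ $hd ≫ prod.fst)
      rw [← e]
      simpa [d] using this.symm
    have hd2 : k ≫ pullback.snd d d ≫ pullback.fst f0 w0 ≫ x0 =
      k ≫ pullback.fst d d ≫ pullback.fst f0 w0 ≫ x0 := by
      have := congr(k ≫ $hd ≫ prod.snd)
      simpa [d] using this.symm
    have claim : ∀ a : Q' ⟶ pullback f0 w0, a ≫ pullback.snd _ _ = r ≫ α0 →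
        ∃ b : Q' ⟶ pullback f (h0 ≫ p), b ≫ pullback.fst _ _ = a ≫ pullback.fst _ _ ≫ x0 ∧
          b ≫ pullback.snd _ _ = r ∧ a ≫ ev0 ≫ pullback.fst g x0 = b ≫ φ := by
      intro a ha
      let z : Q' ⟶ pullback f0 h0 := pullback.lift (a ≫ pullback.fst _ _) r (by
        rw [Category.assoc, pullback.condition, reassoc_of% ha, k1])
      refine ⟨z ≫ ψ, by simp [ψ, z], by simp [ψ, z], ?_⟩
      have := k2 Q' hQ' z a (by simp [z]) (by simp [z, ha])
      rw [← reassoc_of% this]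
      simp
    obtain ⟨b, b1, b2, b3⟩ := claim (k ≫ pullback.fst d d) (by simpa using e)
    obtain ⟨b', b1', b2', b3'⟩ := claim (k ≫ pullback.snd d d) (by simpa using hd1)
    have : b = b' := by
      apply pullback.hom_ext
      · rw [b1, b1']; simpa using hd2.symm
      · rw [b2, b2']
    subst this
    have := b3.trans b3'.symm
    simpa using this)
  refine ⟨α, by rw [← k1]; simp, ?_⟩
  intro Q hQ z z' e1 e2
  obtain ⟨a, a1, a2, a3⟩ := hev Q hQ z'
  have k1' : α ≫ n ≫ w0 = h0 := by simpa using k1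
  let y : Q ⟶ pullback f0 h0 := pullback.lift (a ≫ pullback.fst _ _) (z ≫ pullback.snd _ _) (by
    rw [Category.assoc, pullback.condition, reassoc_of% a2, ← reassoc_of% e2, k1', Category.assoc])
  have hy : y ≫ ψ = z := by
    apply pullback.hom_ext
    · simp [y, ψ, a1, e1]
    · simp [y, ψ]
  have := k2 Q hQ y a (by simp [y]) (by simp [y, a2, ← reassoc_of% e2])
  rw [← a3, ← reassoc_of% this, ← hy]
  simp

theorem Good.all {P : Set E} (hP : IsProjectiveCover P) {X J Y T W : E} {f : X ⟶ J} {h : T ⟶ J}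
    {φ : pullback f h ⟶ Y} {w : W ⟶ J} {ev : pullback f w ⟶ Y} {α : T ⟶ W}
    (H : Good P f h φ w ev α) {Q : E} (z : Q ⟶ pullback f h) (z' : Q ⟶ pullback f w)
    (e1 : z ≫ pullback.fst f h = z' ≫ pullback.fst f w)
    (e2 : z ≫ pullback.snd f h ≫ α = z' ≫ pullback.snd f w) : z ≫ φ = z' ≫ ev :=
  cover_ext hP fun R hR a => by
    have := H R hR (a ≫ z) (a ≫ z') (by simp [e1]) (by simp [e2])
    simpa using this

theorem lemD (hE : IsExact E) {P : Set E} (hP : IsProjectiveCover P) (H : HasGWDP P)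
    {X J Y : E} (f : X ⟶ J) (g : Y ⟶ X) :
    ∃ (W : E) (w : W ⟶ J) (ev : pullback f w ⟶ Y), WPi P f g w ev ∧
      ∀ T ∈ P, ∀ (h : T ⟶ J) (φ : pullback f h ⟶ Y) (α α' : T ⟶ W), α ≫ w = h → α' ≫ w = h →
        Good P f h φ w ev α → Good P f h φ w ev α' → α = α' := by
  obtain ⟨W, w, ev, hev, hW⟩ := lemC hE hP H f g
  obtain ⟨k, hk0, hk⟩ : ∃ k, k = pullback.fst w w ≫ w ∧ k = pullback.snd w w ≫ w :=
    ⟨_, rfl, pullback.condition⟩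
  obtain ⟨R, n, hn, hR⟩ := lemB hE hP H (pullback.snd f k)
    (pullback.lift (pullback.fst f k) (pullback.snd f k ≫ pullback.fst w w)
      (by rw [pullback.condition, Category.assoc, ← hk0]) ≫ ev)
    (pullback.lift (pullback.fst f k) (pullback.snd f k ≫ pullback.snd w w)
      (by rw [pullback.condition, Category.assoc, ← hk]) ≫ ev)
  have char : ∀ Q ∈ P, ∀ w1 w2 : Q ⟶ W, w1 ≫ w = w2 ≫ w →
      ((∃ ρ : Q ⟶ R, ρ ≫ n ≫ pullback.fst w w = w1 ∧ ρ ≫ n ≫ pullback.snd w w = w2) ↔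
        ∀ Q' ∈ P, ∀ (r : Q' ⟶ Q) (z z' : Q' ⟶ pullback f w),
          z ≫ pullback.fst f w = z' ≫ pullback.fst f w → z ≫ pullback.snd f w = r ≫ w1 →
          z' ≫ pullback.snd f w = r ≫ w2 → z ≫ ev = z' ≫ ev) := by
    intro Q hQ w1 w2 e
    have h1 : (∃ ρ : Q ⟶ R, ρ ≫ n ≫ pullback.fst w w = w1 ∧ ρ ≫ n ≫ pullback.snd w w = w2) ↔
        ∃ ρ : Q ⟶ R, ρ ≫ n = pullback.lift w1 w2 e := by
      constructor
      · rintro ⟨ρ, h1, h2⟩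
        exact ⟨ρ, by apply pullback.hom_ext <;> simp [h1, h2]⟩
      · rintro ⟨ρ, h1⟩
        exact ⟨ρ, by rw [reassoc_of% h1]; simp, by rw [reassoc_of% h1]; simp⟩
    rw [h1, hR Q hQ]
    constructor
    · intro h Q' hQ' r z z' e1 e2 e3
      have := h Q' hQ' r (pullback.lift (z ≫ pullback.fst f w) (r ≫ pullback.lift w1 w2 e) (by
        simp only [hk0, Category.assoc, pullback.lift_fst_assoc]
        rw [pullback.condition, reassoc_of% e2])) (by simp)
      simp only [← Category.assoc] at this
      convert this using 2
      · apply pullback.hom_ext <;> simp [e2]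
      · apply pullback.hom_ext <;> simp [e1, e3]
    · intro h Q' hQ' r x e1
      have := h Q' hQ' r (x ≫ pullback.lift (pullback.fst f k) (pullback.snd f k ≫ pullback.fst w w)
          (by rw [pullback.condition, Category.assoc, ← hk0]))
        (x ≫ pullback.lift (pullback.fst f k) (pullback.snd f k ≫ pullback.snd w w)
          (by rw [pullback.condition, Category.assoc, ← hk])) (by simp)
          (by simp [reassoc_of% e1]) (by simp [reassoc_of% e1])
      simpa using this
  have hcond : ∀ {Q : E} (ρ : Q ⟶ R), ρ ≫ (n ≫ pullback.fst w w) ≫ w =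
      ρ ≫ (n ≫ pullback.snd w w) ≫ w := by
    intro Q ρ; simp [pullback.condition]
  have lift_all : ∀ {Q : E} (w1 w2 : Q ⟶ W), w1 ≫ w = w2 ≫ w →
      (∀ Q' ∈ P, ∀ q : Q' ⟶ Q, ∃ ρ : Q' ⟶ R, ρ ≫ n ≫ pullback.fst w w = q ≫ w1 ∧
        ρ ≫ n ≫ pullback.snd w w = q ≫ w2) →
      ∃ ρ : Q ⟶ R, ρ ≫ n ≫ pullback.fst w w = w1 ∧ ρ ≫ n ≫ pullback.snd w w = w2 := by
    intro Q w1 w2 e h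
    obtain ⟨ρ, hρ⟩ := factor_mono hP n (pullback.lift w1 w2 e) (fun Q' hQ' q => by
      obtain ⟨ρ, h1, h2⟩ := h Q' hQ' q
      exact ⟨ρ, by apply pullback.hom_ext <;> simp [h1, h2]⟩)
    exact ⟨ρ, by rw [reassoc_of% hρ]; simp, by rw [reassoc_of% hρ]; simp⟩
  have heq : IsEquivRelPair (n ≫ pullback.fst w w) (n ≫ pullback.snd w w) := by
    refine ⟨?_, ?_, ?_, ?_⟩
    · intro T h h' e1 e2
      rw [← cancel_mono n]
      apply pullback.hom_ext <;> simpa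
    · refine lift_all _ _ rfl fun Q hQ q => (char Q hQ _ _ rfl).2 ?_
      intro Q' hQ' r z z' e1 e2 e3
      have : z = z' := by apply pullback.hom_ext; exact e1; exact e2.trans e3.symm
      rw [this]
    · refine lift_all _ _ (by simpa using (hcond (𝟙 _)).symm) fun Q hQ q => (char Q hQ _ _ ?_).2 ?_
      · simp only [Category.assoc]; simpa using (hcond q).symm
      intro Q' hQ' r z z' e1 e2 e3
      exact ((char Q hQ (q ≫ n ≫ pullback.fst w w) (q ≫ n ≫ pullback.snd w w)
        (by simpa using hcond q)).1 ⟨q, by simp, by simp⟩ Q' hQ' r z' z e1.symm e3 e2).symm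
    · intro T p q e
      refine lift_all _ _ (by
        have h1 := hcond p
        have h2 := hcond q
        simp only [Category.assoc] at h1 h2 e ⊢
        rw [h1, reassoc_of% e, h2]) fun Q hQ t => (char Q hQ _ _ ?_).2 ?_
      · simp only [Category.assoc]
        have h1 := hcond p
        have h2 := hcond q
        simp only [Category.assoc] at h1 h2 e
        rw [h1, reassoc_of% e, h2]
      intro Q' hQ' r z z' e1 e2 e3
      have h1 := (char Q hQ (t ≫ p ≫ n ≫ pullback.fst w w) (t ≫ p ≫ n ≫ pullback.snd w w)
        (by simpa using hcond (t ≫ p))).1 ⟨t ≫ p, by simp, by simp⟩ Q' hQ' r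
      have h2 := (char Q hQ (t ≫ q ≫ n ≫ pullback.fst w w) (t ≫ q ≫ n ≫ pullback.snd w w)
        (by simpa using hcond (t ≫ q))).1 ⟨t ≫ q, by simp, by simp⟩ Q' hQ' r
      let y : Q' ⟶ pullback f w := pullback.lift (z ≫ pullback.fst f w)
        (r ≫ t ≫ p ≫ n ≫ pullback.snd w w) (by
          have := hcond (r ≫ t ≫ p)
          simp only [Category.assoc] at this ⊢
          rw [← this, pullback.condition, reassoc_of% e2])
      rw [h1 z y (by simp [y]) e2 (by simp [y])]
      exact h2 y z' (by simp [y, e1]) (by simp [y, e]) e3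
  obtain ⟨Pr, q, hq, ⟨hcol⟩, hpb⟩ := hE.effective _ _ heq
  have hreg : RegEpi q := ⟨⟨_, _, _, hq, hcol⟩⟩
  have := hreg.epi'
  obtain ⟨π, hπ⟩ : ∃ π : Pr ⟶ J, q ≫ π = w := by
    obtain ⟨π, hπ⟩ := Cofork.IsColimit.desc' hcol w (by simpa using hcond (𝟙 _))
    exact ⟨π, hπ⟩
  have hπa : ∀ {Q : E} (v : Q ⟶ W), v ≫ w = (v ≫ q) ≫ π := by
    intro Q v; rw [Category.assoc, hπ]
  -- characterisation of equality in the quotient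
  have qeq : ∀ Q ∈ P, ∀ w1 w2 : Q ⟶ W, w1 ≫ w = w2 ≫ w → (w1 ≫ q = w2 ≫ q ↔ 
      ∀ Q' ∈ P, ∀ (r : Q' ⟶ Q) (z z' : Q' ⟶ pullback f w),
          z ≫ pullback.fst f w = z' ≫ pullback.fst f w → z ≫ pullback.snd f w = r ≫ w1 →
          z' ≫ pullback.snd f w = r ≫ w2 → z ≫ ev = z' ≫ ev) := by
    intro Q hQ w1 w2 e
    rw [← char Q hQ w1 w2 e]
    constructor
    · intro h
      exact ⟨hpb.lift w1 w2 h, hpb.lift_fst _ _ _, hpb.lift_snd _ _ _⟩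
    · rintro ⟨ρ, rfl, rfl⟩
      simpa using congr(ρ ≫ $hq)
  obtain ⟨ε, hε⟩ := mapOfRel hP (A := pullback f π) (B := Y)
    (fun Q z y => ∃ a : Q ⟶ pullback f w, a ≫ pullback.fst _ _ = z ≫ pullback.fst _ _ ∧
      a ≫ pullback.snd _ _ ≫ q = z ≫ pullback.snd _ _ ∧ a ≫ ev = y)
    (by
      rintro Q _ Q' _ r z y ⟨v, h1, h2, h3⟩
      exact ⟨r ≫ v, by simp [h1], by simp [h2], by simp [h3]⟩)
    (by
      intro Q hQ z
      obtain ⟨v, hv⟩ := hP.1 Q hQ q hreg (z ≫ pullback.snd _ _)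
      exact ⟨_, pullback.lift (z ≫ pullback.fst _ _) v (by
        rw [hπa, hv, Category.assoc, Category.assoc, pullback.condition]), by simp, by simp [hv], rfl⟩)
    (by
      rintro Q hQ z y y' ⟨v, h1, h2, rfl⟩ ⟨v', h1', h2', rfl⟩
      refine (qeq Q hQ (v ≫ pullback.snd _ _) (v' ≫ pullback.snd _ _) ?_).1 ?_ Q hQ (𝟙 _) v v'
        (h1.trans h1'.symm) (by simp) (by simp)
      · rw [hπa, hπa, Category.assoc v, h2, Category.assoc v', h2']
      · simp [h2, h2'])
  -- values of ε
  have hε' : ∀ Q ∈ P, ∀ (a : Q ⟶ pullback f w) (z : Q ⟶ pullback f π),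
      a ≫ pullback.fst _ _ = z ≫ pullback.fst _ _ →
      a ≫ pullback.snd _ _ ≫ q = z ≫ pullback.snd _ _ → a ≫ ev = z ≫ ε := by
    intro Q hQ v z h1 h2
    obtain ⟨v', h1', h2', h3'⟩ := hε Q hQ z
    rw [← h3']
    refine (qeq Q hQ (v ≫ pullback.snd _ _) (v' ≫ pullback.snd _ _) ?_).1 ?_ Q hQ (𝟙 _) v v'
        (h1.trans h1'.symm) (by simp) (by simp)
    · rw [hπa, hπa, Category.assoc v, h2, Category.assoc v', h2']
    · simp [h2, h2']
  refine ⟨Pr, π, ε, ⟨cover_ext hP fun Q hQ z => ?_, ?_⟩, ?_⟩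
  · obtain ⟨v, h1, h2, h3⟩ := hε Q hQ z
    rw [← Category.assoc, ← h3, ← h1, Category.assoc, hev]
  · intro T hT h φ hφ
    obtain ⟨α, h1, h2⟩ := hW T hT h φ hφ
    refine ⟨α ≫ q, by rw [Category.assoc, hπ, h1], ?_⟩
    intro Q hQ z z' e1 e2
    let y : Q ⟶ pullback f w := pullback.lift (z ≫ pullback.fst _ _) (z ≫ pullback.snd _ _ ≫ α)
      (by simp [h1, pullback.condition])
    rw [h2 Q hQ z y (by simp [y]) (by simp [y])]
    exact hε' Q hQ y z' (by simp [y, e1]) (by simp [y, e2])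
  · intro T hT h φ α α' h1 h2 h3 h4
    obtain ⟨β, rfl⟩ := hP.1 T hT q hreg α
    obtain ⟨β', rfl⟩ := hP.1 T hT q hreg α'
    rw [Category.assoc, hπ] at h1 h2
    refine (qeq T hT β β' (h1.trans h2.symm)).2 ?_
    intro Q hQ r z z' e1 e2 e3
    let y : Q ⟶ pullback f h := pullback.lift (z ≫ pullback.fst _ _) r (by
      rw [Category.assoc, pullback.condition, reassoc_of% e2, h1])
    have hm : ∀ a : Q ⟶ pullback f w, ∃ b : Q ⟶ pullback f π,
      a ≫ pullback.fst _ _ = b ≫ pullback.fst _ _ ∧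
      a ≫ pullback.snd _ _ ≫ q = b ≫ pullback.snd _ _ := fun a =>
        ⟨pullback.lift (a ≫ pullback.fst _ _) (a ≫ pullback.snd _ _ ≫ q)
          (by simp [hπ, pullback.condition]), by simp, by simp⟩
    obtain ⟨b, b1, b2⟩ := hm z
    obtain ⟨b', b1', b2'⟩ := hm z'
    rw [hε' Q hQ z b b1 b2, hε' Q hQ z' b' b1' b2']
    rw [← h3 Q hQ y b (by simp [y, b1]) (by simp [y, ← b2, reassoc_of% e2])]
    rw [← h4 Q hQ y b' (by simp [y, e1, b1']) (by simp [y, ← b2', reassoc_of% e3])]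

theorem lemE (hE : IsExact E) {P : Set E} (hP : IsProjectiveCover P) (H : HasGWDP P)
    {X J Y : E} (f : X ⟶ J) (g : Y ⟶ X) :
    ∃ (W : E) (w : W ⟶ J) (ev : pullback f w ⟶ Y), ev ≫ g = pullback.fst f w ∧
      ∀ (T : E) (h : T ⟶ J) (φ : pullback f h ⟶ Y), φ ≫ g = pullback.fst f h →
        ∃! α : T ⟶ W, α ≫ w = h ∧ Good P f h φ w ev α := by
  obtain ⟨W, w, ev, ⟨hev, hW⟩, hun⟩ := lemD hE hP H f g
  refine ⟨W, w, ev, hev, fun T h φ hφ => ?_⟩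
  have hres : ∀ {Q : E} (t : Q ⟶ T), (pullback.fst f (t ≫ h)) ≫ f =
    (pullback.snd f (t ≫ h) ≫ t) ≫ h := by intro Q t; rw [pullback.condition, Category.assoc]
  -- restriction of φ along t
  let res : ∀ {Q : E} (t : Q ⟶ T), pullback f (t ≫ h) ⟶ Y := fun {Q} t =>
    pullback.lift (pullback.fst f (t ≫ h)) (pullback.snd f (t ≫ h) ≫ t) (hres t) ≫ φ
  have un : ∀ Q ∈ P, ∀ (t : Q ⟶ T) (b b' : Q ⟶ W), 
     (b ≫ w = t ≫ h ∧ Good P f (t ≫ h) (res t) w ev b) →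
     (b' ≫ w = t ≫ h ∧ Good P f (t ≫ h) (res t) w ev b') → b = b' := by
    rintro Q hQ t b b' ⟨h1, h2⟩ ⟨h1', h2'⟩
    exact hun Q hQ _ _ b b' h1 h1' h2 h2'
  obtain ⟨α, hα⟩ := mapOfRel hP (A := T) (B := W)
    (fun Q t b => b ≫ w = t ≫ h ∧ Good P f (t ≫ h) (res t) w ev b)
    (by
      rintro Q hQ Q' hQ' r t b ⟨h1, h2⟩
      refine ⟨by simp [h1], ?_⟩
      intro Q'' hQ'' z z' e1 e2
      let y : Q'' ⟶ pullback f (t ≫ h) := pullback.lift (z ≫ pullback.fst _ _)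
        (z ≫ pullback.snd _ _ ≫ r) (by simp [pullback.condition])
      rw [← h2 Q'' hQ'' y z' (by simp [y, e1]) (by simp [y, e2])]
      simp only [res, ← Category.assoc]
      congr 1
      apply pullback.hom_ext <;> simp [y])
    (by
      intro Q hQ t
      exact hW Q hQ (t ≫ h) (res t) (by simp [res, hφ]))
    un
  refine ⟨α, ⟨cover_ext hP fun Q hQ a => by simpa using (hα Q hQ a).1, ?_⟩, ?_⟩
  · intro Q hQ z z' e1 e2
    obtain ⟨h1, h2⟩ := hα Q hQ (z ≫ pullback.snd _ _)
    let y : Q ⟶ pullback f ((z ≫ pullback.snd f h) ≫ h) := pullback.lift (z ≫ pullback.fst _ _) (𝟙 _)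
      (by simp [pullback.condition])
    rw [← h2 Q hQ y z' (by simp [y, e1]) (by simp [y, e2])]
    simp only [res, ← Category.assoc]
    congr 1
    apply pullback.hom_ext <;> simp [y]
  · rintro β ⟨h1, h2⟩
    refine cover_ext hP fun Q hQ t => un Q hQ t _ _ ⟨by simp [h1], ?_⟩ (hα Q hQ t)
    intro Q' hQ' z z' e1 e2
    simp only [res, ← Category.assoc]
    exact h2 Q' hQ' _ z' (by simp [e1]) (by simp [e2])

theorem isLeftAdjoint_of_univ {C D : Type*} [Category C] [Category D] (L : C ⥤ D)
    (h : ∀ B : D, ∃ (R : C) (ev : L.obj R ⟶ B), ∀ (T : C) (φ : L.obj T ⟶ B),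
      ∃! α : T ⟶ R, L.map α ≫ ev = φ) : L.IsLeftAdjoint := by
  have : ∀ B, HasTerminal (CostructuredArrow L B) := by
    intro B
    obtain ⟨R, ev, H⟩ := h B
    refine IsTerminal.hasTerminal (X := CostructuredArrow.mk ev) ?_
    refine IsTerminal.ofUniqueHom
      (fun T => CostructuredArrow.homMk (H T.left T.hom).choose ?_) ?_
    · exact (H T.left T.hom).choose_spec.1
    · intro T m
      ext
      exact (H T.left T.hom).choose_spec.2 m.left (CostructuredArrow.w m)
  exact isLeftAdjoint_of_costructuredArrowTerminals L

theorem prodPB {I : E} (T F : Over I) :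
    IsPullback (prod.snd : T ⨯ F ⟶ F).left (prod.fst : T ⨯ F ⟶ T).left F.hom T.hom := by
  have := IsLimit.pullbackConeEquivBinaryFanInverse (f := T.hom) (g := F.hom)
    (prodIsProd T F)
  exact (IsPullback.of_isLimit this).flip

theorem backward (hE : IsExact E) {P : Set E} (hP : IsProjectiveCover P) (H : HasGWDP P) :
    LocallyCartesianClosedP E := by
  intro I F
  apply isLeftAdjoint_of_univ
  intro B
  obtain ⟨Wo, ev, hev, hW⟩ : ∃ (Wo : Over I) (ev : pullback F.hom Wo.hom ⟶ pullback B.hom F.hom),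
      ev ≫ pullback.snd B.hom F.hom = pullback.fst F.hom Wo.hom ∧
      ∀ (T : E) (h : T ⟶ I) (φ : pullback F.hom h ⟶ pullback B.hom F.hom),
        φ ≫ pullback.snd _ _ = pullback.fst _ _ →
        ∃! α : T ⟶ Wo.left, α ≫ Wo.hom = h ∧ Good P F.hom h φ Wo.hom ev α := by
    obtain ⟨W, w, ev, h1, h2⟩ := lemE hE hP H F.hom (pullback.snd B.hom F.hom)
    exact ⟨Over.mk w, ev, h1, h2⟩
  have s := fun T : Over I => prodPB T F
  have s1 := fun T : Over I => (s T).isoPullback_hom_fst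
  have s2 := fun T : Over I => (s T).isoPullback_hom_snd
  have s3 := fun T : Over I => (s T).isoPullback_inv_fst
  have s4 := fun T : Over I => (s T).isoPullback_inv_snd
  have hev1 : (ev ≫ pullback.fst _ _) ≫ B.hom = pullback.snd _ _ ≫ Wo.hom := by
    rw [Category.assoc, pullback.condition, reassoc_of% hev, pullback.condition]
  let ε : Wo ⨯ F ⟶ B := Over.homMk ((s Wo).isoPullback.hom ≫ ev ≫ pullback.fst _ _)
    (by
      rw [Category.assoc, hev1, ← Category.assoc, s2 Wo]
      exact Over.w (prod.fst : Wo ⨯ F ⟶ Wo))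
  refine ⟨Wo, ε, fun T φ => ?_⟩
  change T ⨯ F ⟶ B at φ
  let φ' : pullback F.hom T.hom ⟶ pullback B.hom F.hom :=
    pullback.lift ((s T).isoPullback.inv ≫ φ.left) (pullback.fst _ _) (by
      rw [Category.assoc, Over.w φ, ← Over.w (prod.snd : T ⨯ F ⟶ F), ← Category.assoc, s3])
  have hφ1 : φ' ≫ pullback.fst _ _ = (s T).isoPullback.inv ≫ φ.left := pullback.lift_fst _ _ _
  have hφ2 : φ' ≫ pullback.snd _ _ = pullback.fst _ _ := pullback.lift_snd _ _ _
  have m1 : ∀ α : T ⟶ Wo, (prod.map α (𝟙 F)).left ≫ (prod.snd : Wo ⨯ F ⟶ F).left =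
      (prod.snd : T ⨯ F ⟶ F).left := by
    intro α
    rw [← Over.comp_left, prod.map_snd, Category.comp_id]
  have m2 : ∀ α : T ⟶ Wo, (prod.map α (𝟙 F)).left ≫ (prod.fst : Wo ⨯ F ⟶ _).left =
      (prod.fst : T ⨯ F ⟶ T).left ≫ α.left := by
    intro α
    rw [← Over.comp_left, prod.map_fst, Over.comp_left]
  have key : ∀ α : T ⟶ Wo, (prod.map α (𝟙 F) ≫ ε = φ) ↔
      Good P F.hom T.hom φ' Wo.hom ev α.left := by
    intro α
    have hl : (prod.map α (𝟙 F) ≫ ε).left =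
        (prod.map α (𝟙 F)).left ≫ (s Wo).isoPullback.hom ≫ ev ≫ pullback.fst _ _ := by
      rw [Over.comp_left]; rfl
    constructor
    · intro h Q hQ z z' e1 e2
      have h' := congr(($h).left)
      rw [hl] at h'
      apply pullback.hom_ext
      · rw [Category.assoc, hφ1, ← h']
        have : z ≫ (s T).isoPullback.inv ≫ (prod.map α (𝟙 F)).left ≫
            (s Wo).isoPullback.hom = z' := by
          apply pullback.hom_ext
          · rw [← e1, ← s3 T]
            simp only [Category.assoc]
            rw [s1 Wo, m1]
          · rw [← e2, ← s4 T]
            simp only [Category.assoc]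
            rw [s2 Wo, m2]
        rw [← this]
        simp
      · rw [Category.assoc, hφ2, Category.assoc, hev, e1]
    · intro h
      ext
      rw [hl]
      have := h.all hP (s T).isoPullback.hom
        ((prod.map α (𝟙 F)).left ≫ (s Wo).isoPullback.hom)
        (by rw [s1, Category.assoc, s1 Wo, m1])
        (by rw [← Category.assoc, s2, Category.assoc, s2 Wo, m2])
      have h2 := congr($this ≫ pullback.fst _ _)
      rw [Category.assoc, hφ1] at h2
      simpa using h2.symm
  obtain ⟨α, ⟨h1, h2⟩, h3⟩ := hW T.left T.hom φ' hφ2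
  refine ⟨Over.homMk α h1, (key _).2 h2, ?_⟩
  intro β hβ
  ext
  exact h3 β.left ⟨Over.w β, (key β).1 hβ⟩

theorem lcc_pi1 (H : LocallyCartesianClosedP E) {J : E} {F G : Over J} (gg : G ⟶ F) :
    ∃ (W : Over J) (ε : W ⨯ F ⟶ G), ε ≫ gg = prod.snd ∧
      ∀ (T : Over J) (φ : T ⨯ F ⟶ G), φ ≫ gg = prod.snd →
        ∃ α : T ⟶ W, prod.map α (𝟙 F) ≫ ε = φ := by
  let L : Over J ⥤ Over J := (prod.functor (C := Over J)).flip.obj F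
  have : L.IsLeftAdjoint := H J F
  let R := L.rightAdjoint
  let adj : L ⊣ R := Adjunction.ofIsLeftAdjoint L
  let pr : ∀ T : Over J, L.obj T ⟶ F := fun T => (prod.snd : T ⨯ F ⟶ F)
  have hpr : ∀ {S T : Over J} (a : S ⟶ T), L.map a ≫ pr T = pr S := by
    intro S T a
    exact (prod.map_snd a (𝟙 F)).trans (Category.comp_id _)
  let EY := R.obj G
  let W := equalizer (R.map gg) (adj.homEquiv _ _ (pr EY))
  let ι : W ⟶ EY := equalizer.ι _ _
  let ε : L.obj W ⟶ G := (adj.homEquiv _ _).symm ι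
  have hε : ε ≫ gg = pr W := by
    apply (adj.homEquiv _ _).injective
    rw [adj.homEquiv_naturality_right, Equiv.apply_symm_apply]
    refine (equalizer.condition _ _).trans ?_
    rw [← adj.homEquiv_naturality_left, hpr]
  have lif : ∀ (T : Over J) (φ : L.obj T ⟶ G), φ ≫ gg = pr T →
      ∃ α : T ⟶ W, L.map α ≫ ε = φ := by
    intro T φ hφ
    refine ⟨equalizer.lift (adj.homEquiv _ _ φ) ?_, ?_⟩
    · rw [← adj.homEquiv_naturality_right, hφ, ← adj.homEquiv_naturality_left, hpr]
    · rw [← adj.homEquiv_naturality_left_symm, Equiv.symm_apply_eq]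
      exact equalizer.lift_ι _ _
  exact ⟨W, ε, hε, lif⟩

theorem lcc_pi2 (P : Set E) (H : LocallyCartesianClosedP E) {J : E} {F G : Over J} (gg : G ⟶ F) :
    ∃ (W : Over J) (ev : pullback F.hom W.hom ⟶ G.left), ev ≫ gg.left = pullback.fst _ _ ∧
      ∀ (T : Over J) (φ : pullback F.hom T.hom ⟶ G.left), φ ≫ gg.left = pullback.fst _ _ →
        ∃ α : T ⟶ W, Good P F.hom T.hom φ W.hom ev α.left := by
  obtain ⟨W, ε, hε, lif⟩ := lcc_pi1 H gg
  have s := fun T : Over J => prodPB T F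
  have s1 := fun T : Over J => (s T).isoPullback_hom_fst
  have s3 := fun T : Over J => (s T).isoPullback_inv_fst
  have s4 := fun T : Over J => (s T).isoPullback_inv_snd
  refine ⟨W, (s W).isoPullback.inv ≫ ε.left, ?_, ?_⟩
  · rw [Category.assoc, ← Over.comp_left, hε, s3 W]
  intro T φ hφ
  let φ' : T ⨯ F ⟶ G :=
    Over.homMk ((s T).isoPullback.hom ≫ φ) (by
      rw [← Over.w gg, Category.assoc, reassoc_of% hφ, ← Category.assoc, s1 T]
      exact Over.w (prod.snd : T ⨯ F ⟶ F))
  obtain ⟨α, hα⟩ := lif T φ' (by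
    ext
    rw [Over.comp_left]
    change ((s T).isoPullback.hom ≫ φ) ≫ gg.left = _
    rw [Category.assoc, hφ, s1 T])
  refine ⟨α, ?_⟩
  intro Q hQ z z' e1 e2
  have h1 : (prod.map α (𝟙 F)).left ≫ ε.left = (s T).isoPullback.hom ≫ φ := congr(($hα).left)
  have m1 : (prod.map α (𝟙 F)).left ≫ (prod.snd : W ⨯ F ⟶ F).left =
      (prod.snd : T ⨯ F ⟶ F).left := by
    rw [← Over.comp_left, prod.map_snd, Category.comp_id]
  have m2 : (prod.map α (𝟙 F)).left ≫ (prod.fst : W ⨯ F ⟶ _).left =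
      (prod.fst : T ⨯ F ⟶ T).left ≫ α.left := by
    rw [← Over.comp_left, prod.map_fst, Over.comp_left]
  have h2 : φ = (s T).isoPullback.inv ≫ (prod.map α (𝟙 F)).left ≫ ε.left := by
    rw [h1, Iso.inv_hom_id_assoc]
  have h3 : z ≫ (s T).isoPullback.inv ≫ (prod.map α (𝟙 F)).left =
      z' ≫ (s W).isoPullback.inv := by
    apply (s W).hom_ext
    · simp only [Category.assoc]
      rw [m1, s3 W, s3 T]
      exact e1
    · simp only [Category.assoc]
      rw [m2, s4 W, reassoc_of% (s4 T)]
      exact e2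
  rw [h2]
  have := congr($h3 ≫ ε.left)
  simpa only [Category.assoc] using this

theorem lcc_pi (P : Set E) (H : LocallyCartesianClosedP E) {X J Y : E} (f : X ⟶ J) (g : Y ⟶ X) :
    ∃ (W : E) (w : W ⟶ J) (ev : pullback f w ⟶ Y), WPi P f g w ev := by
  obtain ⟨W, ev, h1, h2⟩ := lcc_pi2 P H
    (Over.homMk g rfl : Over.mk (g ≫ f) ⟶ Over.mk f)
  refine ⟨W.left, W.hom, ev, h1, ?_⟩
  intro T hT h φ hφ
  obtain ⟨α, hα⟩ := h2 (Over.mk h) φ hφ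
  exact ⟨α.left, Over.w α, hα⟩

theorem forward (hE : IsExact E) {P : Set E} (hP : IsProjectiveCover P)
    (H : LocallyCartesianClosedP E) : HasGWDP P := by
  intro Y1 Y0 X J hY1 hY0 hX hJ y₁ y₂ hy g f hyg
  obtain ⟨R, e, m, he, hm, hem, heq⟩ := hy
  have hy1 : y₁ = e ≫ m ≫ prod.fst := by rw [reassoc_of% hem]; simp
  have hy2 : y₂ = e ≫ m ≫ prod.snd := by rw [reassoc_of% hem]; simp
  have := he.epi'
  obtain ⟨Y, q, hq, ⟨hcol⟩, hpb⟩ := hE.effective _ _ heq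
  have hreg : RegEpi q := ⟨⟨_, _, _, hq, hcol⟩⟩
  have hqy : y₁ ≫ q = y₂ ≫ q := by rw [hy1, hy2]; simpa using congr(e ≫ $hq)
  have liftY : ∀ Q ∈ P, ∀ a b : Q ⟶ Y0, a ≫ q = b ≫ q →
      ∃ t : Q ⟶ Y1, t ≫ y₁ = a ∧ t ≫ y₂ = b := by
    intro Q hQ a b h
    obtain ⟨t, ht⟩ := hP.1 Q hQ e he (hpb.lift a b h)
    refine ⟨t, ?_, ?_⟩
    · rw [hy1, reassoc_of% ht]; exact hpb.lift_fst _ _ _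
    · rw [hy2, reassoc_of% ht]; exact hpb.lift_snd _ _ _
  obtain ⟨g', hg'⟩ : ∃ g' : Y ⟶ X, q ≫ g' = g := by
    obtain ⟨g', h⟩ := Cofork.IsColimit.desc' hcol g (by
      rw [hy1, hy2] at hyg
      rw [← cancel_epi e]
      simpa using hyg)
    exact ⟨g', h⟩
  obtain ⟨W0, w0, ev0, hev0, hW0⟩ := lcc_pi P H f g'
  obtain ⟨W, hW, c, hc⟩ := hP.2 W0
  let ev : pullback f (c ≫ w0) ⟶ Y := pullback.lift (pullback.fst _ _) (pullback.snd _ _ ≫ c)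
    (by rw [pullback.condition, Category.assoc]) ≫ ev0
  have hev : ev ≫ g' = pullback.fst _ _ := by simp [ev, hev0]
  obtain ⟨V, hV, d, hd⟩ := hP.2 (pullback ev q)
  have surj : ∀ Q ∈ P, ∀ (z : Q ⟶ pullback f (c ≫ w0)) (y : Q ⟶ Y0), z ≫ ev = y ≫ q →
      ∃ v : Q ⟶ V, v ≫ d ≫ pullback.fst _ _ = z ∧ v ≫ d ≫ pullback.snd _ _ = y := by
    intro Q hQ z y h
    obtain ⟨v, hv⟩ := hP.1 Q hQ d hd (pullback.lift z y h)
    exact ⟨v, by rw [reassoc_of% hv]; simp, by rw [reassoc_of% hv]; simp⟩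
  have hcomm : (d ≫ pullback.fst _ _ ≫ pullback.fst f (c ≫ w0)) ≫ f =
      (d ≫ pullback.fst ev q ≫ pullback.snd f (c ≫ w0)) ≫ c ≫ w0 := by
    simp [pullback.condition]
  refine ⟨W, V, c ≫ w0, d ≫ pullback.fst _ _ ≫ pullback.fst _ _,
    d ≫ pullback.fst _ _ ≫ pullback.snd _ _, d ≫ pullback.snd ev q, ⟨hW, hcomm, ⟨hV, hcomm, ?_⟩,
      ?_, ?_⟩, ?_⟩
  · intro V' hV' a' b' hab
    obtain ⟨y, hy⟩ := hP.1 V' hV' q hreg (pullback.lift a' b' hab ≫ ev)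
    obtain ⟨v, h1, h2⟩ := surj V' hV' _ y hy.symm
    exact ⟨v, by rw [reassoc_of% h1]; simp, by rw [reassoc_of% h1]; simp⟩
  · rw [← hg', Category.assoc, ← pullback.condition_assoc, hev]
  · intro V1 v₁ v₂ hv
    refine liftY V1 hv.mem _ _ ?_
    have : pullback.lift _ _ hcomm = d ≫ pullback.fst _ _ := by
      apply pullback.hom_ext <;> simp
    have h := hv.w
    rw [this] at h
    simp only [Category.assoc] at h ⊢
    rw [← (pullback.condition : _ = pullback.snd ev q ≫ q), reassoc_of% h]
  intro W' V' w' a' b' e' hcone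
  have hV' := hcone.wpb
  have hsurj : RegEpi (pullback.lift a' b' hV'.comm) := surj_regEpi hE hP _ (fun Q hQ z => by
    obtain ⟨h, h1, h2⟩ := hV'.lift hQ (z ≫ pullback.fst f w') (z ≫ pullback.snd f w')
      (by simp [pullback.condition])
    exact ⟨h, by apply pullback.hom_ext <;> simp [h1, h2]⟩)
  obtain ⟨V1, v₁, v₂, hv, hv'⟩ := exists_equality hP _ hsurj
  obtain ⟨t, ht1, ht2⟩ := hcone.pres v₁ v₂ hv
  obtain ⟨hcol'⟩ := hv.coeq
  obtain ⟨φ, hφ⟩ : ∃ φ : pullback f w' ⟶ Y, pullback.lift a' b' hV'.comm ≫ φ = e' ≫ q := by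
    obtain ⟨φ, h⟩ := Cofork.IsColimit.desc' hcol' (e' ≫ q) (by
      rw [← reassoc_of% ht1, ← reassoc_of% ht2, hqy])
    exact ⟨φ, h⟩
  have := hsurj.epi'
  obtain ⟨α0, h1, h2⟩ := hW0 W' hcone.memW w' φ (by
    rw [← cancel_epi (pullback.lift a' b' hV'.comm), reassoc_of% hφ, hg', hcone.overX]
    simp)
  obtain ⟨α, rfl⟩ := hP.1 W' hcone.memW c hc α0
  have h1' : α ≫ c ≫ w0 = w' := by simpa using h1
  let z : V' ⟶ pullback f (c ≫ w0) := pullback.lift a' (b' ≫ α) (by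
    rw [hV'.comm, Category.assoc, h1'])
  obtain ⟨β, k1, k2⟩ := surj V' hV'.mem z e' (by
    rw [← hφ, h2.all hP (pullback.lift a' b' hV'.comm) (z ≫ pullback.lift (pullback.fst _ _)
      (pullback.snd _ _ ≫ c) (by rw [pullback.condition, Category.assoc])) (by simp [z])
      (by simp [z])]
    simp [ev])
  exact ⟨α, β, h1', by rw [reassoc_of% k1]; simp [z], by rw [reassoc_of% k1]; simp [z], k2⟩

end Aux

/-- `E` is locally cartesian closed iff `P` is weakly locally cartesian
closed, i.e. `P` has generalised weak dependent products. -/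
theorem stmt18 {E : Type u} [Category.{v} E] [HasFiniteLimits E]
    (hE : IsExact E) (P : Set E) (hP : IsProjectiveCover P) :
    LocallyCartesianClosedP E ↔ HasGWDP P := by
  exact ⟨fun H => forward hE hP H, fun H => backward hE hP H⟩

end ExComp
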